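/- For every finite simple graph G on ℓ vertices, the additive code C(G) ⊆ 𝔽₄^ℓ generated by G is self-dual with respect to the trace Hermitian inner product; in particular C(G) has exactly 2^ℓ elements. -/

import Mathlib

attribute [local instance] Classical.propDecidable

/-- The Hamming weight of a word: its number of nonzero entries. -/
noncomputable def wt {V F : Type*} [Zero F] (c : V → F) : ℕ :=
  {v | c v ≠ 0}.ncard

/-- The additive code `C(G)` generated by a graph `G`: the `𝔽₂`-linear span (equivalently,
the additive span, since the scalars are `{0, 1}`) of the rows of `A + ω • I`, where `A` is
the adjacency matrix of `G`. -/
noncomputable def graphCode {V F : Type*} [Field F]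
    (G : SimpleGraph V) (ω : F) : AddSubgroup (V → F) :=
  AddSubgroup.closure
    (Set.range fun v : V => fun w : V =>
      (if G.Adj v w then (1 : F) else 0) + if v = w then ω else 0)

/-- The trace Hermitian inner product `x * y = ∑ⱼ (xⱼ yⱼ² + xⱼ² yⱼ)`. -/
noncomputable def traceInner {V F : Type*} [Fintype V] [CommRing F] (x y : V → F) : F :=
  ∑ v, (x v * y v ^ 2 + x v ^ 2 * y v)

/-- A code is (symplectic) self-dual if it equals its dual with respect to the
trace Hermitian inner product. -/
def SelfDual {V F : Type*} [Fintype V] [CommRing F] (C : AddSubgroup (V → F)) : Prop :=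
  (C : Set (V → F)) = {x | ∀ c ∈ C, traceInner x c = 0}

section GraphCode

variable {V F : Type*} [Field F]

/-- The row of `A + ω • I` indexed by the vertex `v`. -/
noncomputable def graphCodeRow (G : SimpleGraph V) (ω : F) (v w : V) : F :=
  (if G.Adj v w then (1 : F) else 0) + if v = w then ω else 0

theorem graphCodeRow_mem (G : SimpleGraph V) (ω : F) (v : V) :
    graphCodeRow G ω v ∈ graphCode G ω :=
  AddSubgroup.subset_closure ⟨v, rfl⟩

theorem traceInner_zero_right [Fintype V] (x : V → F) : traceInner x 0 = 0 := by
  simp [traceInner]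

theorem traceInner_add_right [Fintype V] [CharP F 2] (x y z : V → F) :
    traceInner x (y + z) = traceInner x y + traceInner x z := by
  simp only [traceInner, ← Finset.sum_add_distrib, Pi.add_apply, CharTwo.add_sq]
  exact Finset.sum_congr rfl fun v _ => by ring

theorem traceInner_comm [Fintype V] (x y : V → F) : traceInner x y = traceInner y x :=
  Finset.sum_congr rfl fun v _ => by ring

theorem traceInner_neg_right [Fintype V] [CharP F 2] (x y : V → F) :
    traceInner x (-y) = traceInner x y := by
  simp [traceInner, CharTwo.neg_eq]

/-- A word is orthogonal to a code as soon as it is orthogonal to the generating rows. -/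
theorem traceInner_eq_zero_of_row [Fintype V] [CharP F 2] {G : SimpleGraph V} {ω : F} {x : V → F}
    (h : ∀ v, traceInner x (graphCodeRow G ω v) = 0) {c : V → F} (hc : c ∈ graphCode G ω) :
    traceInner x c = 0 := by
  induction hc using AddSubgroup.closure_induction with
  | mem _ hy => obtain ⟨v, rfl⟩ := hy; exact h v
  | zero => exact traceInner_zero_right x
  | add y z _ _ hy hz => rw [traceInner_add_right, hy, hz, add_zero]
  | neg y _ hy => rw [traceInner_neg_right, hy]

theorem traceInner_graphCodeRow [Fintype V] (G : SimpleGraph V) (ω : F)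
    (x : V → F) (v : V) :
    traceInner x (graphCodeRow G ω v) =
      ∑ w, (if G.Adj v w then x w + x w ^ 2 else 0) + (x v * ω ^ 2 + x v ^ 2 * ω) := by
  have key : ∀ w, x w * graphCodeRow G ω v w ^ 2 + x w ^ 2 * graphCodeRow G ω v w =
      (if G.Adj v w then x w + x w ^ 2 else 0) +
        if v = w then x w * ω ^ 2 + x w ^ 2 * ω else 0 := by
    intro w
    by_cases hvw : v = w
    · subst hvw
      simp [graphCodeRow]
    · by_cases hadj : G.Adj v w <;> simp [graphCodeRow, hvw, hadj]
  simp [traceInner, key, Finset.sum_add_distrib]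

theorem graphCodeRow_add_sq [CharP F 2] (G : SimpleGraph V) {ω : F}
    (hω : ω ^ 2 = ω + 1) (v w : V) :
    graphCodeRow G ω v w + graphCodeRow G ω v w ^ 2 = if v = w then 1 else 0 := by
  by_cases hvw : v = w
  · subst hvw
    simp [graphCodeRow, hω, ← add_assoc, CharTwo.add_self_eq_zero]
  · by_cases hadj : G.Adj v w <;> simp [graphCodeRow, hvw, hadj, CharTwo.add_self_eq_zero]

theorem traceInner_graphCodeRow_graphCodeRow [Fintype V] [CharP F 2] (G : SimpleGraph V) {ω : F}
    (hω : ω ^ 2 = ω + 1) (u v : V) :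
    traceInner (graphCodeRow G ω u) (graphCodeRow G ω v) = 0 := by
  rw [traceInner_graphCodeRow G]
  by_cases huv : u = v
  · subst huv
    have h : ∀ w, (if G.Adj u w then (if u = w then (1 : F) else 0) else 0) = 0 := by
      intro w
      split_ifs with h1 h2
      · exact absurd h2 h1.ne
      all_goals rfl
    simp only [graphCodeRow_add_sq G hω, h]
    simp only [graphCodeRow, SimpleGraph.irrefl, if_false, if_true, zero_add,
      Finset.sum_const_zero]
    rw [mul_comm, CharTwo.add_self_eq_zero]
  · have h : ∀ w, (if G.Adj v w then (if u = w then (1 : F) else 0) else 0) =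
        if u = w then (if G.Adj u v then 1 else 0) else 0 := by
      intro w
      by_cases huw : u = w
      · subst huw
        simp [G.adj_comm]
      · simp [huw]
    simp only [graphCodeRow_add_sq G hω, h]
    by_cases hadj : G.Adj u v
    · simp [graphCodeRow, huv, hadj, hω, add_assoc]
      linear_combination CharTwo.add_self_eq_zero (ω + 1)
    · simp [graphCodeRow, huv, hadj]

theorem traceInner_eq_zero_of_mem_graphCode [Fintype V] [CharP F 2] {G : SimpleGraph V} {ω : F}
    (hω : ω ^ 2 = ω + 1) {x c : V → F} (hx : x ∈ graphCode G ω) (hc : c ∈ graphCode G ω) :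
    traceInner x c = 0 := by
  refine traceInner_eq_zero_of_row (fun v => ?_) hc
  rw [traceInner_comm]
  exact traceInner_eq_zero_of_row (fun u => traceInner_graphCodeRow_graphCodeRow G hω v u) hx

theorem sum_graphCodeRow_add_sq [Fintype V] [CharP F 2] (G : SimpleGraph V) {ω : F}
    (hω : ω ^ 2 = ω + 1) (S : Finset V) (w : V) :
    (∑ v ∈ S, graphCodeRow G ω v) w + (∑ v ∈ S, graphCodeRow G ω v) w ^ 2 =
      if w ∈ S then 1 else 0 := by
  rw [Finset.sum_apply, CharTwo.sum_sq, ← Finset.sum_add_distrib]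
  simp [graphCodeRow_add_sq G hω]

/-- A word orthogonal to the rows of `A + ω • I` is the sum of the rows indexed by the vertices
at which its trace does not vanish. -/
theorem eq_sum_graphCodeRow [Fintype V] [Fintype F] (hF : Fintype.card F = 4) [CharP F 2]
    (G : SimpleGraph V) {ω : F} (hω : ω ^ 2 = ω + 1) {x : V → F}
    (h : ∀ v, traceInner x (graphCodeRow G ω v) = 0) :
    x = ∑ v with x v + x v ^ 2 ≠ 0, graphCodeRow G ω v := by
  have trace_eq : ∀ w, x w + x w ^ 2 = if x w + x w ^ 2 ≠ 0 then 1 else 0 := by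
    intro w
    have h4 : x w ^ 4 = x w := hF ▸ FiniteField.pow_card (x w)
    split_ifs with h0
    · refine mul_left_cancel₀ h0 ?_
      linear_combination h4 + x w ^ 3 * CharTwo.two_eq_zero (R := F)
    · exact not_not.mp h0
  ext w
  have hw := h w
  rw [traceInner_graphCodeRow G] at hw
  have hsum : ∀ v, (if x v + x v ^ 2 ≠ 0 then graphCodeRow G ω v w else 0) =
      (if G.Adj w v then x v + x v ^ 2 else 0) + if v = w then (x w + x w ^ 2) * ω else 0 := by
    intro v
    have hv : (if x v + x v ^ 2 ≠ 0 then graphCodeRow G ω v w else 0) =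
        (x v + x v ^ 2) * graphCodeRow G ω v w := by
      conv_rhs => rw [trace_eq v]
      split_ifs <;> simp
    rw [hv, graphCodeRow, G.adj_comm]
    by_cases hvw : v = w
    · subst hvw
      simp
    · by_cases hadj : G.Adj w v <;> simp [hvw, hadj]
  rw [Finset.sum_apply, Finset.sum_filter, Finset.sum_congr rfl fun v _ => hsum v,
    Finset.sum_add_distrib, Finset.sum_ite_eq' Finset.univ w, if_pos (Finset.mem_univ w)]
  rw [hω] at hw
  linear_combination x w * CharTwo.two_eq_zero (R := F) - hw

end GraphCode

/-- For every finite simple graph `G` on `ℓ` vertices, the additive code `C(G) ⊆ 𝔽₄^ℓ`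
generated by `G` is self-dual with respect to the trace Hermitian inner product; in
particular `C(G)` has exactly `2^ℓ` elements. -/
theorem graphCode_selfDual (V : Type) [Fintype V] (G : SimpleGraph V)
    (F : Type) [Field F] [Fintype F] (hF : Fintype.card F = 4)
    (ω : F) (hω : ω ^ 2 = ω + 1) :
    SelfDual (graphCode G ω) ∧ Nat.card (graphCode G ω) = 2 ^ Fintype.card V := by
  have : CharP F 2 := by
    have h2 : (2 : F) = 0 := by
      have h4 : ((4 : ℕ) : F) = 0 := hF ▸ FiniteField.cast_card_eq_zero F
      refine pow_eq_zero_iff (n := 2) two_ne_zero |>.mp ?_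
      norm_num at h4 ⊢
      exact h4
    exact CharTwo.of_one_ne_zero_of_two_eq_zero one_ne_zero h2
  have mem_sum (S : Finset V) : ∑ v ∈ S, graphCodeRow G ω v ∈ graphCode G ω :=
    sum_mem fun v _ => graphCodeRow_mem G ω v
  constructor
  · ext x
    refine ⟨fun hx c hc => traceInner_eq_zero_of_mem_graphCode hω hx hc, fun hx => ?_⟩
    rw [eq_sum_graphCodeRow hF G hω fun v => hx _ (graphCodeRow_mem G ω v)]
    exact mem_sum _
  · let f (S : Finset V) : graphCode G ω := ⟨_, mem_sum S⟩
    have hf : Function.Bijective f := by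
      constructor
      · intro S T hST
        ext w
        have h := sum_graphCodeRow_add_sq G hω S w
        rw [show ∑ v ∈ S, graphCodeRow G ω v = ∑ v ∈ T, graphCodeRow G ω v from
          congrArg Subtype.val hST, sum_graphCodeRow_add_sq G hω T w] at h
        by_cases hS : w ∈ S <;> by_cases hT : w ∈ T <;> simp_all
      · rintro ⟨x, hx⟩
        exact ⟨_, Subtype.ext (eq_sum_graphCodeRow hF G hω fun v =>
          traceInner_eq_zero_of_mem_graphCode hω hx (graphCodeRow_mem G ω v)).symm⟩
    rw [← Nat.card_eq_of_bijective f hf, Nat.card_eq_fintype_card, Fintype.card_finset]
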